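/- Under the LWR setup, define Ψ : U → M₂(ℂ) by Ψ(z) := Φ(λ1,z)·Φ(λ0,z)⁻¹. Then Ψ is holomorphic on U with det Ψ(z) = 1 for all z, and its derivative satisfies Ψ′(z) = (λ1−λ0)·Φ(λ1,z)·A(z)·Φ(λ0,z)⁻¹ for all z ∈ U; in particular det Ψ′(z) = 0 everywhere, so Ψ is a holomorphic null curve into SL₂ℂ. -/

import Mathlib

open Matrix

attribute [local instance] Matrix.normedAddCommGroup Matrix.normedSpace

/-- 2×2 complex matrices. -/
abbrev M2 : Type := Matrix (Fin 2) (Fin 2) ℂ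

/-- Matrix-valued functions are differentiated entrywise. -/
theorem hasDerivAt_matrix_iff {m n : Type*} [Fintype m] [Fintype n]
    {f : ℂ → Matrix m n ℂ} {f' : Matrix m n ℂ} {z : ℂ} :
    HasDerivAt f f' z ↔ ∀ i j, HasDerivAt (fun w => f w i j) (f' i j) z := by
  refine (hasDerivAt_pi (φ := f) (φ' := f')).trans (forall_congr' fun i => ?_)
  exact hasDerivAt_pi (φ := fun w => f w i) (φ' := f' i)

/-- The product rule for matrix-valued functions. -/
theorem HasDerivAt.matrix_mul_rule {l m n : Type*} [Fintype l] [Fintype m] [Fintype n]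
    {f : ℂ → Matrix l m ℂ} {g : ℂ → Matrix m n ℂ} {f' : Matrix l m ℂ} {g' : Matrix m n ℂ}
    {z : ℂ} (hf : HasDerivAt f f' z) (hg : HasDerivAt g g' z) :
    HasDerivAt (fun w => f w * g w) (f' * g z + f z * g') z := by
  rw [hasDerivAt_matrix_iff] at *
  intro i j
  simp only [Matrix.mul_apply, Matrix.add_apply, ← Finset.sum_add_distrib]
  exact HasDerivAt.fun_sum fun k _ => (hf i k).mul (hg k j)

/-- On `2 × 2` matrices the adjugate is linear, hence commutes with differentiation. -/
theorem HasDerivAt.adjugate_fin_two {f : ℂ → M2} {f' : M2} {z : ℂ} (hf : HasDerivAt f f' z) :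
    HasDerivAt (fun w => (f w).adjugate) f'.adjugate z := by
  rw [hasDerivAt_matrix_iff] at *
  intro i j
  fin_cases i <;> fin_cases j <;> simp [Matrix.adjugate_fin_two] <;>
    first
      | exact hf _ _
      | exact (hf _ _).fun_neg

/-- The adjugate of a trace-free `2 × 2` matrix is its negative. -/
theorem adjugate_eq_neg_of_trace_eq_zero {X : M2} (hX : X.trace = 0) : X.adjugate = -X := by
  rw [Matrix.trace_fin_two] at hX
  ext i j
  fin_cases i <;> fin_cases j <;> simp [Matrix.adjugate_fin_two] <;> linear_combination hX

/-- Under the LWR setup, the map `Ψ(z) := Φ(λ1,z)·Φ(λ0,z)⁻¹` is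
holomorphic on `U` with `det Ψ ≡ 1`, and its derivative is
`Ψ′(z) = (λ1−λ0)·Φ(λ1,z)·A(z)·Φ(λ0,z)⁻¹`, whose determinant vanishes everywhere;
so `Ψ` is a holomorphic null curve into `SL₂ℂ`.
Here `l0 ≠ l1` are the evaluation points. -/
theorem lwr_null_curve_sl2_group
    (U : Set ℂ) (hU : IsOpen U)
    (A B : ℂ → M2) (Φ : ℂ → ℂ → M2)
    (hA : DifferentiableOn ℂ A U) (hB : DifferentiableOn ℂ B U)
    (htrA : ∀ z ∈ U, (A z).trace = 0) (htrB : ∀ z ∈ U, (B z).trace = 0)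
    (hA2 : ∀ z ∈ U, A z * A z = 0)
    (hΦ : DifferentiableOn ℂ (fun p : ℂ × ℂ => Φ p.1 p.2) (Set.univ ×ˢ U))
    (hΦdet : ∀ μ : ℂ, ∀ z ∈ U, (Φ μ z).det = 1)
    (hΦz : ∀ μ : ℂ, ∀ z ∈ U, HasDerivAt (fun w => Φ μ w) (Φ μ z * (μ • A z + B z)) z)
    (l0 l1 : ℂ) (hl : l0 ≠ l1) :
    ∀ z ∈ U,
      HasDerivAt (fun w => Φ l1 w * (Φ l0 w)⁻¹)
        ((l1 - l0) • (Φ l1 z * A z * (Φ l0 z)⁻¹)) z ∧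
      (Φ l1 z * (Φ l0 z)⁻¹).det = 1 ∧
      ((l1 - l0) • (Φ l1 z * A z * (Φ l0 z)⁻¹)).det = 0 := by
  intro z hz
  have hinv : ∀ μ : ℂ, ∀ w ∈ U, (Φ μ w)⁻¹ = (Φ μ w).adjugate := fun μ w hw => by
    simp [Matrix.inv_def, hΦdet μ w hw]
  have htr : (l0 • A z + B z).trace = 0 := by
    simp [htrA z hz, htrB z hz]
  refine ⟨?_, ?_, ?_⟩
  · have hder := (hΦz l1 z hz).matrix_mul_rule (hΦz l0 z hz).adjugate_fin_two
    rw [Matrix.adjugate_mul_distrib, adjugate_eq_neg_of_trace_eq_zero htr] at hder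
    have hval : (l1 - l0) • (Φ l1 z * A z * (Φ l0 z)⁻¹) =
        Φ l1 z * (l1 • A z + B z) * (Φ l0 z).adjugate +
          Φ l1 z * (-(l0 • A z + B z) * (Φ l0 z).adjugate) := by
      rw [hinv l0 z hz, ← Matrix.mul_assoc, ← Matrix.add_mul, ← Matrix.mul_add,
        ← Matrix.smul_mul, ← Matrix.mul_smul]
      congr 2
      module
    rw [hval]
    refine hder.congr_of_eventuallyEq ?_
    filter_upwards [hU.mem_nhds hz] with w hw
    rw [hinv l0 w hw]
  · simp [Matrix.det_mul, Matrix.det_nonsing_inv, hΦdet _ z hz]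
  · have hdetA : (A z).det = 0 := by
      have h := congrArg Matrix.det (hA2 z hz)
      simpa [Matrix.det_mul] using h
    simp [Matrix.det_mul, hdetA]
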